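/- Let p(x) = qx + r with q, r ∈ ℚ and q ≠ 0. For every base b ≥ 2 and every infinite set A ⊆ ℕ (with p(n) ≥ 0 for all n ∈ A), dim_FS(CE_b(A)) = dim_FS(CE_b(p(A))) and Dim_FS(CE_b(A)) = Dim_FS(CE_b(p(A))), where CE_b(p(A)) is the concatenation of the base-b expansions of the integer parts ⌊p(n)⌋ for n ∈ A in increasing order of n. -/

import Mathlib

/-- Number of sliding-block occurrences of `w` in `s`:
`N(w,s) = |{i : s[i…i+|w|−1] = w}|`. -/
def slideN {α : Type*} [DecidableEq α] (w s : List α) : ℕ :=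
  ((Finset.range (s.length + 1 - w.length)).filter
    (fun i => ((s.drop i).take w.length) = w)).card

/-- Sliding count probability of `w` in `s`: `P(w,s) = N(w,s)/(|s|−|w|+1)`. -/
noncomputable def slideP {α : Type*} [DecidableEq α] (w s : List α) : ℝ :=
  (slideN w s : ℝ) / ((s.length : ℝ) - (w.length : ℝ) + 1)

/-- `l`-th sliding block entropy of a string, with logarithms base `|α|`.
The convention `0 · log(1/0) = 0` holds automatically since `Real.logb b 0⁻¹ = 0`. -/
noncomputable def slideH {α : Type*} [Fintype α] [DecidableEq α] (l : ℕ) (x : List α) : ℝ :=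
  (1 / (l : ℝ)) * ∑ w : Fin l → α,
    slideP (List.ofFn w) x * Real.logb (Fintype.card α) (slideP (List.ofFn w) x)⁻¹

/-- The prefix `S[0…n]` of a sequence, i.e. its first `n+1` symbols. -/
def pre {α : Type*} (S : ℕ → α) (n : ℕ) : List α := List.ofFn (fun i : Fin (n + 1) => S i)

/-- Finite-state dimension via sliding block entropies:
`dim_FS(S) = inf_{l ≥ 1} liminf_{n→∞} H_l(S[0…n])`. -/
noncomputable def dimFS {α : Type*} [Fintype α] [DecidableEq α] (S : ℕ → α) : ℝ :=
  ⨅ l : ℕ, Filter.liminf (fun n => slideH (l + 1) (pre S n)) Filter.atTop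

/-- Finite-state strong dimension:
`Dim_FS(S) = inf_{l ≥ 1} limsup_{n→∞} H_l(S[0…n])`. -/
noncomputable def DimFS {α : Type*} [Fintype α] [DecidableEq α] (S : ℕ → α) : ℝ :=
  ⨅ l : ℕ, Filter.limsup (fun n => slideH (l + 1) (pre S n)) Filter.atTop
/-- Cumulative lengths of a sequence of lists. -/
def cumLen {α : Type*} (L : ℕ → List α) : ℕ → ℕ
  | 0 => 0
  | m + 1 => cumLen L m + (L m).length

open scoped Classical in
/-- The infinite sequence obtained by concatenating the lists `L 0, L 1, L 2, …`
(a default symbol is used in the degenerate case where the total length is finite). -/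
noncomputable def concatSeq {α : Type*} (dflt : α) (L : ℕ → List α) (k : ℕ) : α :=
  if h : ∃ m, k < cumLen L (m + 1) then
    (L (Nat.find h)).getD (k - cumLen L (Nat.find h)) dflt
  else dflt
/-- Big-endian base-`b` digit string of `n`, as symbols in `Σ_b = Fin b`. -/
def digitsFin (b : ℕ) (hb : 0 < b) (n : ℕ) : List (Fin b) :=
  (Nat.digits b n).reverse.map (fun d => ⟨d % b, Nat.mod_lt d hb⟩)

/-- The base-`b` Copeland–Erdős sequence `CE_b(A)` of an infinite set `A ⊆ ℕ`:
the concatenation of the base-`b` expansions of the elements of `A` in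
increasing order (`Nat.nth (· ∈ A)` enumerates `A` in increasing order). -/
noncomputable def CEseq (b : ℕ) (hb : 0 < b) (A : Set ℕ) : ℕ → Fin b :=
  concatSeq ⟨0, hb⟩ (fun i => digitsFin b hb (Nat.nth (· ∈ A) i))

/-- The base-`b` Copeland–Erdős sequence `CE_b(f(A))` for `f : ℕ → ℝ`:
the concatenation of the base-`b` expansions of the integer parts `⌊f(n)⌋`
for `n ∈ A` in increasing order of `n`. -/
noncomputable def CEseqF (b : ℕ) (hb : 0 < b) (A : Set ℕ) (f : ℕ → ℝ) : ℕ → Fin b :=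
  concatSeq ⟨0, hb⟩ (fun i => digitsFin b hb ⌊f (Nat.nth (· ∈ A) i)⌋₊)

section EmpiricalEntropy

variable {ι κ α β : Type*}

/-- Frequency with which `X` takes the value `x` on the finite index set `I`. -/
noncomputable def empFreq [DecidableEq α] (I : Finset ι) (X : ι → α) (x : α) : ℝ :=
  ((I.filter (fun i => X i = x)).card : ℝ) / I.card

/-- Entropy (in nats) of the empirical distribution of `X` on `I`. -/
noncomputable def empEntropy [Fintype α] [DecidableEq α] (I : Finset ι) (X : ι → α) : ℝ :=
  ∑ x, Real.negMulLog (empFreq I X x)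

lemma empFreq_nonneg [DecidableEq α] (I : Finset ι) (X : ι → α) (x : α) :
    0 ≤ empFreq I X x := by
  unfold empFreq; positivity

lemma empFreq_le_one [DecidableEq α] (I : Finset ι) (X : ι → α) (x : α) :
    empFreq I X x ≤ 1 := by
  unfold empFreq
  exact div_le_one_of_le₀ (by exact_mod_cast Finset.card_filter_le _ _) (by positivity)

lemma sum_empFreq_le_one [Fintype α] [DecidableEq α] (I : Finset ι) (X : ι → α) :
    ∑ x, empFreq I X x ≤ 1 := by
  unfold empFreq
  rw [← Finset.sum_div]
  refine div_le_one_of_le₀ ?_ (by positivity)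
  rw [Finset.card_eq_sum_card_fiberwise (f := X) (t := Finset.univ) (fun _ _ => by simp)]
  push_cast
  exact le_rfl

lemma sum_empFreq_pair_right [DecidableEq α] [Fintype β] [DecidableEq β] (I : Finset ι)
    (X : ι → α) (Y : ι → β) (x : α) :
    ∑ y, empFreq I (fun i => (X i, Y i)) (x, y) = empFreq I X x := by
  unfold empFreq
  rw [← Finset.sum_div]
  congr 1
  rw [Finset.card_eq_sum_card_fiberwise (f := Y) (t := Finset.univ) (fun _ _ => by simp)]
  push_cast
  simp only [Finset.filter_filter, Prod.mk.injEq]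

lemma sum_empFreq_pair_left [Fintype α] [DecidableEq α] [DecidableEq β] (I : Finset ι)
    (X : ι → α) (Y : ι → β) (y : β) :
    ∑ x, empFreq I (fun i => (X i, Y i)) (x, y) = empFreq I Y y := by
  rw [← sum_empFreq_pair_right I Y X y]
  refine Finset.sum_congr rfl fun x _ => ?_
  simp only [empFreq, Prod.mk.injEq, and_comm]

lemma empFreq_pair_eq_zero [DecidableEq α] [DecidableEq β] {I : Finset ι}
    {X : ι → α} {Y : ι → β} {R : α → Finset β} (h : ∀ i ∈ I, Y i ∈ R (X i)) {x : α} {y : β}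
    (hy : y ∉ R x) : empFreq I (fun i => (X i, Y i)) (x, y) = 0 := by
  have : I.filter (fun i => (X i, Y i) = (x, y)) = ∅ := by
    rw [Finset.filter_eq_empty_iff]
    rintro i hi heq
    obtain ⟨rfl, rfl⟩ := Prod.mk.inj heq
    exact hy (h i hi)
  rw [empFreq, this]
  simp

lemma empEntropy_nonneg [Fintype α] [DecidableEq α] (I : Finset ι) (X : ι → α) :
    0 ≤ empEntropy I X :=
  Finset.sum_nonneg fun x _ =>
    Real.negMulLog_nonneg (empFreq_nonneg I X x) (empFreq_le_one I X x)

lemma negMulLog_le_one {x : ℝ} (hx : 0 ≤ x) : Real.negMulLog x ≤ 1 := by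
  rcases hx.eq_or_lt with rfl | hx
  · simp
  · have h := Real.log_le_sub_one_of_pos (inv_pos.2 hx)
    rw [Real.log_inv] at h
    have h2 := mul_le_mul_of_nonneg_left h hx.le
    rw [mul_sub, mul_inv_cancel₀ hx.ne'] at h2
    unfold Real.negMulLog
    linarith

lemma empEntropy_le_card [Fintype α] [DecidableEq α] (I : Finset ι) (X : ι → α) :
    empEntropy I X ≤ Fintype.card α := by
  refine (Finset.sum_le_card_nsmul _ _ 1
    fun x _ => negMulLog_le_one (empFreq_nonneg I X x)).trans ?_
  simp

lemma mul_log_sub_log_le {p s t : ℝ} (hp : 0 < p) (hs : 0 < s) (ht : 0 < t) :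
    p * (Real.log s - Real.log t - Real.log p) ≤ s / t - p := by
  have h := Real.log_le_sub_one_of_pos (show 0 < s / t / p by positivity)
  rw [Real.log_div (by positivity) hp.ne', Real.log_div hs.ne' ht.ne'] at h
  refine (mul_le_mul_of_nonneg_left h hp.le).trans (le_of_eq ?_)
  field_simp

/-- If `X` determines `Y` up to `K` possibilities, then the entropy of `Y` exceeds that of `X`
by at most `log K`. -/
lemma empEntropy_le_add_log [Fintype α] [DecidableEq α] [Fintype β] [DecidableEq β]
    (I : Finset ι) (X : ι → α) (Y : ι → β) (R : α → Finset β) (K : ℕ) (hK : 0 < K)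
    (hR : ∀ x, (R x).card ≤ K) (h : ∀ i ∈ I, Y i ∈ R (X i)) :
    empEntropy I Y ≤ empEntropy I X + Real.log K := by
  set p : α → β → ℝ := fun x y => empFreq I (fun i => (X i, Y i)) (x, y) with hp
  have hX : ∀ x, ∑ y, p x y = empFreq I X x := sum_empFreq_pair_right I X Y
  have hY : ∀ y, ∑ x, p x y = empFreq I Y y := sum_empFreq_pair_left I X Y
  have hp0 : ∀ x y, 0 ≤ p x y := fun x y => empFreq_nonneg _ _ _
  have hK' : (0 : ℝ) < K := by exact_mod_cast hK
  have hlogK : 0 ≤ Real.log K := Real.log_natCast_nonneg K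
  have hpt : ∀ x y, p x y * (Real.log (empFreq I X x) - Real.log (empFreq I Y y)) ≤
      p x y * Real.log K + ((if y ∈ R x then empFreq I X x / K else 0) - p x y) := by
    intro x y
    rcases (hp0 x y).eq_or_lt with h0 | h0
    · rw [← h0]
      have := empFreq_nonneg I X x
      rw [zero_mul, zero_mul, zero_add, sub_zero]
      split_ifs <;> positivity
    · have hy : y ∈ R x := by
        by_contra hy
        exact h0.ne' (empFreq_pair_eq_zero h hy)
      have hpx : p x y ≤ empFreq I X x := by
        rw [← hX]; exact Finset.single_le_sum (fun y _ => hp0 x y) (Finset.mem_univ y)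
      have hpy : p x y ≤ empFreq I Y y := by
        rw [← hY]
        exact Finset.single_le_sum (f := fun x => p x y) (fun x _ => hp0 x y) (Finset.mem_univ x)
      have h1 := mul_log_sub_log_le h0 (h0.trans_le hpx) hK'
      have h2 := mul_le_mul_of_nonneg_left (Real.log_le_log h0 hpy) h0.le
      rw [if_pos hy]
      nlinarith
  have hsum := Finset.sum_le_sum fun x (_ : x ∈ Finset.univ) =>
    Finset.sum_le_sum fun y (_ : y ∈ Finset.univ) => hpt x y
  have hL : ∑ x, ∑ y, p x y * (Real.log (empFreq I X x) - Real.log (empFreq I Y y)) =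
      empEntropy I Y - empEntropy I X := by
    simp only [mul_sub, Finset.sum_sub_distrib]
    rw [Finset.sum_comm (f := fun x y => p x y * Real.log (empFreq I Y y))]
    simp only [← Finset.sum_mul, hX, hY, empEntropy, Real.negMulLog, neg_mul,
      Finset.sum_neg_distrib]
    ring
  have hr : ∑ x, ∑ y, (p x y * Real.log K +
      ((if y ∈ R x then empFreq I X x / K else 0) - p x y)) ≤ Real.log K := by
    simp only [Finset.sum_add_distrib, Finset.sum_sub_distrib, ← Finset.sum_mul, hX]
    have h1 := mul_le_mul_of_nonneg_right (sum_empFreq_le_one I X) hlogK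
    have h2 : ∑ x, ∑ y, (if y ∈ R x then empFreq I X x / K else 0) ≤ ∑ x, empFreq I X x := by
      refine Finset.sum_le_sum fun x _ => ?_
      rw [Finset.sum_ite_mem, Finset.univ_inter, Finset.sum_const, nsmul_eq_mul,
        mul_div_assoc', div_le_iff₀ hK', mul_comm]
      exact mul_le_mul_of_nonneg_left (by exact_mod_cast hR x) (empFreq_nonneg I X x)
    linarith
  linarith

lemma empEntropy_pair_le [Fintype α] [DecidableEq α] [Fintype β] [DecidableEq β]
    (I : Finset ι) (X : ι → α) (Y : ι → β) :
    empEntropy I (fun i => (X i, Y i)) ≤ empEntropy I X + empEntropy I Y := by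
  set p : α → β → ℝ := fun x y => empFreq I (fun i => (X i, Y i)) (x, y) with hp
  have hX : ∀ x, ∑ y, p x y = empFreq I X x := sum_empFreq_pair_right I X Y
  have hY : ∀ y, ∑ x, p x y = empFreq I Y y := sum_empFreq_pair_left I X Y
  have hp0 : ∀ x y, 0 ≤ p x y := fun x y => empFreq_nonneg _ _ _
  have hpt : ∀ x y, p x y *
      (Real.log (empFreq I X x) + Real.log (empFreq I Y y) - Real.log (p x y)) ≤
      empFreq I X x * empFreq I Y y - p x y := by
    intro x y
    rcases (hp0 x y).eq_or_lt with h0 | h0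
    · rw [← h0]
      have := empFreq_nonneg I X x
      have := empFreq_nonneg I Y y
      simp; positivity
    · have hpx : p x y ≤ empFreq I X x := by
        rw [← hX]; exact Finset.single_le_sum (fun y _ => hp0 x y) (Finset.mem_univ y)
      have hpy : p x y ≤ empFreq I Y y := by
        rw [← hY]
        exact Finset.single_le_sum (f := fun x => p x y) (fun x _ => hp0 x y) (Finset.mem_univ x)
      have h1 := mul_log_sub_log_le h0
        (mul_pos (h0.trans_le hpx) (h0.trans_le hpy)) one_pos
      rwa [Real.log_mul (h0.trans_le hpx).ne' (h0.trans_le hpy).ne', Real.log_one, sub_zero,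
        div_one] at h1
  have hsum := Finset.sum_le_sum fun x (_ : x ∈ Finset.univ) =>
    Finset.sum_le_sum fun y (_ : y ∈ Finset.univ) => hpt x y
  have hL : ∑ x, ∑ y, p x y *
      (Real.log (empFreq I X x) + Real.log (empFreq I Y y) - Real.log (p x y)) =
      empEntropy I (fun i => (X i, Y i)) - empEntropy I X - empEntropy I Y := by
    have hXY : empEntropy I (fun i => (X i, Y i)) = ∑ x, ∑ y, Real.negMulLog (p x y) :=
      Fintype.sum_prod_type _
    rw [hXY]
    simp only [mul_sub, mul_add, Finset.sum_sub_distrib, Finset.sum_add_distrib]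
    rw [Finset.sum_comm (f := fun x y => p x y * Real.log (empFreq I Y y))]
    simp only [← Finset.sum_mul, hX, hY, empEntropy, Real.negMulLog, neg_mul,
      Finset.sum_neg_distrib]
    ring
  have hr : ∑ x, ∑ y, (empFreq I X x * empFreq I Y y - p x y) ≤ 0 := by
    simp only [Finset.sum_sub_distrib, ← Finset.mul_sum, hX, ← Finset.sum_mul]
    have h1 := sum_empFreq_le_one I Y
    have h2 : 0 ≤ ∑ x, empFreq I X x := Finset.sum_nonneg fun x _ => empFreq_nonneg I X x
    nlinarith
  linarith

lemma empEntropy_image [DecidableEq κ] [Fintype α] [DecidableEq α] (I : Finset ι) (f : ι → κ)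
    (X : κ → α) (hf : Set.InjOn f I) :
    empEntropy (I.image f) X = empEntropy I (fun i => X (f i)) := by
  unfold empEntropy empFreq
  refine Finset.sum_congr rfl fun x _ => ?_
  rw [Finset.card_image_of_injOn hf, Finset.filter_image,
    Finset.card_image_of_injOn (hf.mono fun i hi => (Finset.mem_filter.1 hi).1)]

lemma abs_empFreq_sub_le [DecidableEq α] {I J : Finset ι} (hJ : J ⊆ I) (X : ι → α) (x : α)
    {δ : ℝ} (hδ : 0 ≤ δ) (h : (I.card : ℝ) - J.card ≤ δ * I.card) :
    |empFreq J X x - empFreq I X x| ≤ δ := by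
  classical
  rcases I.eq_empty_or_nonempty with rfl | hI
  · rw [Finset.subset_empty.1 hJ]; simpa
  have hB : (0 : ℝ) < I.card := by exact_mod_cast hI.card_pos
  have h1 : ((I.card : ℝ) - J.card) / I.card ≤ δ := by rwa [div_le_iff₀ hB]
  rcases J.eq_empty_or_nonempty with rfl | hJ0
  · have h2 : 1 ≤ δ := by simpa [hB.ne'] using h1
    have h3 := empFreq_nonneg I X x
    have h4 := empFreq_le_one I X x
    have h5 : empFreq ∅ X x = 0 := by simp [empFreq]
    rw [h5, abs_le]
    constructor <;> linarith
  have hA : (0 : ℝ) < J.card := by exact_mod_cast hJ0.card_pos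
  have hAB : (J.card : ℝ) ≤ I.card := by exact_mod_cast Finset.card_le_card hJ
  have hab : ((J.filter (fun i => X i = x)).card : ℝ) ≤ (I.filter (fun i => X i = x)).card := by
    exact_mod_cast Finset.card_le_card (Finset.filter_subset_filter _ hJ)
  have haA : ((J.filter (fun i => X i = x)).card : ℝ) ≤ J.card := by
    exact_mod_cast Finset.card_filter_le _ _
  have hba : ((I.filter (fun i => X i = x)).card : ℝ) + J.card ≤
      (J.filter (fun i => X i = x)).card + I.card := by
    have h1 : I.filter (fun i => X i = x) ⊆ J.filter (fun i => X i = x) ∪ (I \ J) := by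
      intro i hi
      simp only [Finset.mem_union, Finset.mem_filter, Finset.mem_sdiff] at hi ⊢
      tauto
    have h2 := (Finset.card_le_card h1).trans (Finset.card_union_le _ _)
    have h3 := Finset.card_sdiff_add_card_eq_card hJ
    exact_mod_cast (by omega :
      (I.filter (fun i => X i = x)).card + J.card ≤ (J.filter (fun i => X i = x)).card + I.card)
  unfold empFreq
  set a : ℝ := ((J.filter (fun i => X i = x)).card : ℝ)
  set c : ℝ := ((I.filter (fun i => X i = x)).card : ℝ)
  have ha : 0 ≤ a := Nat.cast_nonneg _
  rw [abs_le]
  constructor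
  · have h2 : a / I.card ≤ a / J.card := div_le_div_of_nonneg_left ha hA hAB
    have h3 : c / I.card ≤ a / I.card + ((I.card : ℝ) - J.card) / I.card := by
      rw [← add_div]; gcongr; linarith
    linarith
  · have h2 : a / I.card ≤ c / I.card := by gcongr
    have h3 : a / J.card ≤ a / I.card + ((I.card : ℝ) - J.card) / I.card := by
      rw [← add_div, div_le_div_iff₀ hA hB]
      nlinarith
    linarith

/-- Passing to a subset of almost full density barely changes the empirical entropy. -/
lemma exists_abs_empEntropy_sub_le [Fintype α] [DecidableEq α] {ε : ℝ} (hε : 0 < ε) :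
    ∃ δ : ℝ, 0 < δ ∧ ∀ (I J : Finset ι) (X : ι → α), J ⊆ I →
      (I.card : ℝ) - J.card ≤ δ * I.card → |empEntropy J X - empEntropy I X| ≤ ε := by
  have huc : UniformContinuousOn Real.negMulLog (Set.Icc 0 1) :=
    isCompact_Icc.uniformContinuousOn_of_continuous Real.continuous_negMulLog.continuousOn
  rw [Metric.uniformContinuousOn_iff_le] at huc
  obtain ⟨δ, hδ, h⟩ := huc (ε / (Fintype.card α + 1)) (by positivity)
  refine ⟨δ, hδ, fun I J X hJ hc => ?_⟩
  unfold empEntropy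
  rw [← Finset.sum_sub_distrib]
  refine (Finset.abs_sum_le_sum_abs _ _).trans ((Finset.sum_le_card_nsmul _ _ _ fun x _ =>
    h _ ⟨empFreq_nonneg J X x, empFreq_le_one J X x⟩ _
      ⟨empFreq_nonneg I X x, empFreq_le_one I X x⟩ (abs_empFreq_sub_le hJ X x hδ.le hc)).trans ?_)
  rw [nsmul_eq_mul, Finset.card_univ, mul_div_assoc', div_le_iff₀ (by positivity)]
  nlinarith

end EmpiricalEntropy

section BlockEntropy

variable {α : Type*}

/-- The length-`l` block of `S` that starts at position `i`. -/
def block (S : ℕ → α) (l i : ℕ) : Fin l → α := fun t => S (i + t)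

/-- Entropy (in nats) of the length-`l` blocks of `S` starting at positions `i < n`. -/
noncomputable def blockEntropy [Fintype α] [DecidableEq α] (S : ℕ → α) (l n : ℕ) : ℝ :=
  empEntropy (Finset.range n) (block S l)

lemma take_drop_pre (S : ℕ → α) {l n i : ℕ} (h : i + l ≤ n + 1) :
    ((pre S n).drop i).take l = List.ofFn (block S l i) := by
  apply List.ext_getElem
  · simp [pre]; omega
  · intro t h1 h2
    simp [pre, block, -List.ofFn_succ]

lemma slideP_ofFn_pre [DecidableEq α] (S : ℕ → α) {l n : ℕ} (h : l ≤ n + 1) (w : Fin l → α) :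
    slideP (List.ofFn w) (pre S n) = empFreq (Finset.range (n + 2 - l)) (block S l) w := by
  unfold slideP slideN empFreq
  have h1 : (pre S n).length = n + 1 := by simp [pre]
  rw [h1, List.length_ofFn, Finset.card_range]
  congr 1
  · congr 2
    refine Finset.filter_congr fun i hi => ?_
    rw [Finset.mem_range] at hi
    rw [take_drop_pre S (by omega), List.ofFn_inj]
  · rw [Nat.cast_sub (by omega)]
    push_cast
    ring

lemma slideH_pre [Fintype α] [DecidableEq α] (S : ℕ → α) {l n : ℕ} (h : l ≤ n + 1) :
    slideH l (pre S n) = empEntropy (Finset.range (n + 2 - l)) (block S l) /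
      (l * Real.log (Fintype.card α)) := by
  unfold slideH empEntropy
  simp only [slideP_ofFn_pre S h]
  rw [Finset.sum_div, Finset.mul_sum]
  refine Finset.sum_congr rfl fun w _ => ?_
  rw [Real.logb, Real.log_inv, Real.negMulLog]
  simp only [div_eq_mul_inv, mul_inv]
  ring

lemma eventually_natCast_le_mul (a : ℝ) {δ : ℝ} (hδ : 0 < δ) :
    ∀ᶠ n : ℕ in Filter.atTop, a ≤ δ * n :=
  ((tendsto_natCast_atTop_atTop (R := ℝ)).const_mul_atTop hδ).eventually_ge_atTop a

/-- Block entropies are asymptotically unaffected by shifting the window of positions. -/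
lemma eventually_empEntropy_shift_le [Fintype α] [DecidableEq α] (X : ℕ → α) (m : ℕ) {ε : ℝ}
    (hε : 0 < ε) : ∀ᶠ n : ℕ in Filter.atTop,
      empEntropy (Finset.range n) (fun i => X (i + m)) ≤ empEntropy (Finset.range n) X + ε := by
  obtain ⟨δ, hδ, h⟩ := exists_abs_empEntropy_sub_le (ι := ℕ) (α := α) (half_pos hε)
  filter_upwards [eventually_natCast_le_mul m hδ, Filter.eventually_ge_atTop m] with n hn hmn
  have himg : empEntropy (Finset.range n) (fun i => X (i + m)) =
      empEntropy (Finset.Ico m (n + m)) X := by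
    rw [← empEntropy_image (Finset.range n) (fun i => i + m) X (add_left_injective m).injOn,
      Finset.range_eq_Ico, Finset.image_add_right_Ico, zero_add]
  have h1 := h (Finset.range n) (Finset.Ico m n) X
    (fun i hi => Finset.mem_range.2 (Finset.mem_Ico.1 hi).2)
    (by rw [Finset.card_range, Nat.card_Ico, Nat.cast_sub hmn]; linarith)
  have h2 := h (Finset.Ico m (n + m)) (Finset.Ico m n) X
    (Finset.Ico_subset_Ico_right (by omega))
    (by rw [Nat.card_Ico, Nat.card_Ico, Nat.add_sub_cancel, Nat.cast_sub hmn]; linarith)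
  rw [himg]
  rw [abs_le] at h1 h2
  linarith

lemma eventually_blockEntropy_add_self_le [Fintype α] [DecidableEq α] (S : ℕ → α) (l : ℕ) {ε : ℝ}
    (hε : 0 < ε) : ∀ᶠ n : ℕ in Filter.atTop,
      blockEntropy S (l + l) n ≤ 2 * blockEntropy S l n + ε := by
  filter_upwards [eventually_empEntropy_shift_le (block S l) l hε] with n hn
  have h1 := empEntropy_le_add_log (Finset.range n)
    (fun i => (block S l i, block S l (i + l))) (block S (l + l))
    (fun x => {Fin.append x.1 x.2}) 1 one_pos (fun x => by simp) (fun i _ => by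
      rw [Finset.mem_singleton]
      funext t
      refine Fin.addCases (fun t => ?_) (fun t => ?_) t
      · rw [Fin.append_left]
        rfl
      · rw [Fin.append_right]
        simp only [block, Fin.val_natAdd, add_assoc])
  have h2 := empEntropy_pair_le (Finset.range n) (block S l) (fun i => block S l (i + l))
  rw [Nat.cast_one, Real.log_one, add_zero] at h1
  unfold blockEntropy
  linarith

/-- Normalized block entropy over the positions `i ≤ n`. -/
noncomputable def blockRate [Fintype α] [DecidableEq α] (S : ℕ → α) (l n : ℕ) : ℝ :=
  blockEntropy S l (n + 1) / (l * Real.log (Fintype.card α))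

lemma eventually_abs_slideH_sub_blockRate_le [Fintype α] [DecidableEq α] (S : ℕ → α) (l : ℕ)
    (hl : 0 < l) (hα : 1 < Fintype.card α) {ε : ℝ} (hε : 0 < ε) : ∀ᶠ n : ℕ in Filter.atTop,
      |slideH l (pre S n) - blockRate S l n| ≤ ε := by
  have hlog : 0 < l * Real.log (Fintype.card α) :=
    mul_pos (by exact_mod_cast hl) (Real.log_pos (by exact_mod_cast hα))
  obtain ⟨δ, hδ, h⟩ := exists_abs_empEntropy_sub_le (ι := ℕ) (α := Fin l → α) (mul_pos hε hlog)
  filter_upwards [eventually_natCast_le_mul l hδ, Filter.eventually_ge_atTop l] with n hn hln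
  have h1 := h (Finset.range (n + 1)) (Finset.range (n + 2 - l)) (block S l)
    (Finset.range_subset_range.2 (by omega))
    (by
      rw [Finset.card_range, Finset.card_range, Nat.cast_sub (by omega)]
      push_cast
      linarith)
  rw [slideH_pre S (by omega), blockRate, ← sub_div, abs_div, abs_of_pos hlog, div_le_iff₀ hlog]
  exact h1

end BlockEntropy

section Alignment

variable {c c' : ℕ → ℕ} {D l n : ℕ}

open scoped Classical in
/-- Pairs of positions `(i, j)` below `n` such that, for some `k`, the length-`l` blocks starting
at `i` and `j` lie inside the `k`-th intervals cut out by `c` and `c'`, at the same distance from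
the right ends of these intervals. -/
noncomputable def alignedPairs (c c' : ℕ → ℕ) (l n : ℕ) : Finset (ℕ × ℕ) :=
  (Finset.range n ×ˢ Finset.range n).filter fun p => ∃ k,
    c k ≤ p.1 ∧ p.1 + l ≤ c (k + 1) ∧ c' k ≤ p.2 ∧ p.2 + l ≤ c' (k + 1) ∧
      p.1 + c' (k + 1) = p.2 + c (k + 1)

lemma mem_alignedPairs {p : ℕ × ℕ} : p ∈ alignedPairs c c' l n ↔ (p.1 < n ∧ p.2 < n) ∧ ∃ k,
    c k ≤ p.1 ∧ p.1 + l ≤ c (k + 1) ∧ c' k ≤ p.2 ∧ p.2 + l ≤ c' (k + 1) ∧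
      p.1 + c' (k + 1) = p.2 + c (k + 1) := by
  simp only [alignedPairs, Finset.mem_filter, Finset.mem_product, Finset.mem_range]

lemma Monotone.eq_of_mem_interval (hc : Monotone c) {k k' i : ℕ} (h1 : c k ≤ i)
    (h2 : i < c (k + 1)) (h3 : c k' ≤ i) (h4 : i < c (k' + 1)) : k = k' := by
  by_contra hne
  rcases Nat.lt_or_gt_of_ne hne with h | h
  · have := hc (show k + 1 ≤ k' from h); omega
  · have := hc (show k' + 1 ≤ k from h); omega

lemma injOn_fst_alignedPairs (hc : Monotone c) (hl : 0 < l) :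
    Set.InjOn Prod.fst (alignedPairs c c' l n : Set (ℕ × ℕ)) := by
  rintro ⟨i, j⟩ h1 ⟨i', j'⟩ h2 (rfl : i = i')
  rw [Finset.mem_coe, mem_alignedPairs] at h1 h2
  obtain ⟨-, k, h⟩ := h1
  obtain ⟨-, k', h'⟩ := h2
  obtain rfl := hc.eq_of_mem_interval h.1 (by omega) h'.1 (by omega)
  simp only [Prod.mk.injEq, true_and]
  omega

lemma injOn_snd_alignedPairs (hc' : Monotone c') (hl : 0 < l) :
    Set.InjOn Prod.snd (alignedPairs c c' l n : Set (ℕ × ℕ)) := by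
  rintro ⟨i, j⟩ h1 ⟨i', j'⟩ h2 (rfl : j = j')
  rw [Finset.mem_coe, mem_alignedPairs] at h1 h2
  obtain ⟨-, k, h⟩ := h1
  obtain ⟨-, k', h'⟩ := h2
  obtain rfl := hc'.eq_of_mem_interval h.2.2.1 (by omega) h'.2.2.1 (by omega)
  simp only [Prod.mk.injEq, and_true]
  omega

lemma le_card_alignedPairs (h0 : c 0 = 0) (h0' : c' 0 = 0)
    (hD : ∀ k, c (k + 1) + c' k ≤ c' (k + 1) + c k + D)
    (hD' : ∀ k, c' (k + 1) + c k ≤ c (k + 1) + c' k + D) (hunb : ∀ i, ∃ k, i < c (k + 1))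
    {K : ℕ} (hK : ∀ k, c k < n → k + 1 ≤ K) :
    n ≤ (alignedPairs c c' l n).card + (2 * D + l) * K := by
  have hdiff : ∀ k, c' k ≤ c k + D * k := by
    intro k
    induction k with
    | zero => omega
    | succ k ih => have := hD' k; rw [Nat.mul_succ]; omega
  have hsub : Finset.range n ⊆ ((alignedPairs c c' l n).image Prod.fst ∪
      (Finset.range K).biUnion
        (fun k => Finset.Ico (c k) (c k + D) ∪ Finset.Ico (c (k + 1) - l) (c (k + 1)))) ∪
      Finset.Ico (n - D * K) n := by
    intro i hi
    rw [Finset.mem_range] at hi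
    obtain ⟨k, hk1, hk2⟩ : ∃ k, c k ≤ i ∧ i < c (k + 1) := by
      classical
      refine ⟨Nat.find (hunb i), ?_, Nat.find_spec (hunb i)⟩
      rcases hf : Nat.find (hunb i) with _ | m
      · omega
      · have := Nat.find_min (hunb i) (m := m) (by omega)
        omega
    have hkK := hK k (by omega)
    have hDk : D * (k + 1) ≤ D * K := Nat.mul_le_mul_left D hkK
    by_cases hb1 : i < c k + D
    · refine Finset.mem_union_left _ (Finset.mem_union_right _ ?_)
      exact Finset.mem_biUnion.2 ⟨k, Finset.mem_range.2 (by omega),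
        Finset.mem_union_left _ (Finset.mem_Ico.2 ⟨hk1, hb1⟩)⟩
    by_cases hb2 : c (k + 1) < i + l
    · refine Finset.mem_union_left _ (Finset.mem_union_right _ ?_)
      exact Finset.mem_biUnion.2 ⟨k, Finset.mem_range.2 (by omega),
        Finset.mem_union_right _ (Finset.mem_Ico.2 ⟨by omega, hk2⟩)⟩
    by_cases hb3 : n ≤ i + D * K
    · exact Finset.mem_union_right _ (Finset.mem_Ico.2 ⟨by omega, hi⟩)
    refine Finset.mem_union_left _ (Finset.mem_union_left _ ?_)
    have h1 := hD k
    have h2 := hdiff (k + 1)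
    refine Finset.mem_image.2 ⟨(i, i + c' (k + 1) - c (k + 1)), ?_, rfl⟩
    exact mem_alignedPairs.2 ⟨⟨hi, by omega⟩, k, hk1, by omega, by omega, by omega, by omega⟩
  have hcard := Finset.card_le_card hsub
  rw [Finset.card_range] at hcard
  have h1 := Finset.card_union_le ((alignedPairs c c' l n).image Prod.fst ∪
      (Finset.range K).biUnion
        (fun k => Finset.Ico (c k) (c k + D) ∪ Finset.Ico (c (k + 1) - l) (c (k + 1))))
      (Finset.Ico (n - D * K) n)
  have h2 := Finset.card_union_le ((alignedPairs c c' l n).image Prod.fst)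
      ((Finset.range K).biUnion
        (fun k => Finset.Ico (c k) (c k + D) ∪ Finset.Ico (c (k + 1) - l) (c (k + 1))))
  have h3 : ((Finset.range K).biUnion (fun k => Finset.Ico (c k) (c k + D) ∪
      Finset.Ico (c (k + 1) - l) (c (k + 1)))).card ≤ K * (D + l) := by
    refine (Finset.card_biUnion_le_card_mul _ _ (D + l) fun k _ => ?_).trans (by simp)
    refine (Finset.card_union_le _ _).trans ?_
    rw [Nat.card_Ico, Nat.card_Ico]
    omega
  have h4 := Finset.card_image_le (s := alignedPairs c c' l n) (f := Prod.fst)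
  rw [Nat.card_Ico] at h1
  have h5 : (2 * D + l) * K = K * (D + l) + D * K := by ring
  omega

lemma exists_mul_le_add (hlen : Filter.Tendsto (fun k => c (k + 1) - c k) Filter.atTop Filter.atTop)
    (hc : Monotone c) (M : ℕ) : ∃ B, ∀ k, M * k ≤ c k + B := by
  obtain ⟨k₀, hk₀⟩ := Filter.eventually_atTop.1 (hlen.eventually_ge_atTop M)
  refine ⟨M * k₀, fun k => ?_⟩
  rcases le_total k k₀ with h | h
  · have := Nat.mul_le_mul_left M h; omega
  · induction k, h using Nat.le_induction with
    | base => omega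
    | succ k hk ih =>
      have h1 := hk₀ k hk
      have h2 := hc (Nat.le_succ k)
      rw [Nat.mul_succ]
      simp only [Nat.succ_eq_add_one] at h2
      omega

lemma eventually_card_alignedPairs (h0 : c 0 = 0) (h0' : c' 0 = 0) (hc : Monotone c)
    (hD : ∀ k, c (k + 1) + c' k ≤ c' (k + 1) + c k + D)
    (hD' : ∀ k, c' (k + 1) + c k ≤ c (k + 1) + c' k + D)
    (hlen : Filter.Tendsto (fun k => c (k + 1) - c k) Filter.atTop Filter.atTop)
    (l : ℕ) {δ : ℝ} (hδ : 0 < δ) : ∀ᶠ n : ℕ in Filter.atTop,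
      (n : ℝ) - (alignedPairs c c' l n).card ≤ δ * n := by
  have hunb : ∀ i, ∃ k, i < c (k + 1) := by
    intro i
    obtain ⟨B, hB⟩ := exists_mul_le_add hlen hc 1
    refine ⟨i + B, ?_⟩
    have := hB (i + B + 1)
    omega
  obtain ⟨M, hM⟩ := exists_nat_gt ((2 * D + l : ℝ) / (δ / 2))
  have hM0 : (0 : ℝ) < M := lt_of_le_of_lt (by positivity) hM
  have hMδ : (2 * D + l : ℝ) / M ≤ δ / 2 := by
    rw [div_lt_iff₀ (by positivity)] at hM
    rw [div_le_iff₀ hM0]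
    linarith
  obtain ⟨B, hB⟩ := exists_mul_le_add hlen hc M
  filter_upwards [eventually_natCast_le_mul ((2 * D + l : ℝ) * (B / M + 1)) (half_pos hδ)]
    with n hn
  have hMpos : 0 < M := by exact_mod_cast hM0
  have h1 := le_card_alignedPairs (l := l) (n := n) (K := (n + B) / M + 1) h0 h0' hD hD' hunb
    (fun k hk => by
      have h2 : k ≤ (n + B) / M := by
        rw [Nat.le_div_iff_mul_le hMpos]
        have := hB k
        rw [mul_comm] at this
        omega
      omega)
  have h2 : (((n + B) / M : ℕ) : ℝ) ≤ (n + B) / M := by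
    refine Nat.cast_div_le.trans (le_of_eq ?_)
    push_cast
    rfl
  have h3 : (n : ℝ) ≤ (alignedPairs c c' l n).card + (2 * D + l) * (((n + B) / M : ℕ) + 1) := by
    exact_mod_cast h1
  have h4 : (2 * D + l : ℝ) * (((n + B) / M : ℕ) + 1) ≤ (2 * D + l) * ((n + B) / M + 1) := by
    gcongr
  have h5 : (2 * D + l : ℝ) * ((n + B) / M + 1) =
      (2 * D + l) / M * n + (2 * D + l) * (B / M + 1) := by
    field_simp
    ring
  have h6 : (2 * D + l : ℝ) / M * n ≤ δ / 2 * n := by gcongr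
  linarith

/-- If blocks of `T` are determined, up to `K` possibilities, by the aligned blocks of `S`, then
the block entropy of `T` asymptotically exceeds that of `S` by at most `log K`. -/
lemma eventually_blockEntropy_le {α : Type*} [Fintype α] [DecidableEq α] {S T : ℕ → α}
    (h0 : c 0 = 0) (h0' : c' 0 = 0) (hc : Monotone c) (hc' : Monotone c')
    (hD : ∀ k, c (k + 1) + c' k ≤ c' (k + 1) + c k + D)
    (hD' : ∀ k, c' (k + 1) + c k ≤ c (k + 1) + c' k + D)
    (hlen : Filter.Tendsto (fun k => c (k + 1) - c k) Filter.atTop Filter.atTop)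
    (hl : 0 < l) (R : (Fin l → α) → Finset (Fin l → α)) {K : ℕ} (hK : 0 < K)
    (hR : ∀ x, (R x).card ≤ K)
    (hST : ∀ n, ∀ p ∈ alignedPairs c c' l n, block T l p.2 ∈ R (block S l p.1))
    {ε : ℝ} (hε : 0 < ε) : ∀ᶠ n : ℕ in Filter.atTop,
      blockEntropy T l n ≤ blockEntropy S l n + Real.log K + ε := by
  obtain ⟨δ, hδ, h⟩ := exists_abs_empEntropy_sub_le (ι := ℕ) (α := Fin l → α) (half_pos hε)
  filter_upwards [eventually_card_alignedPairs h0 h0' hc hD hD' hlen l hδ] with n hn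
  have hmem : ∀ p ∈ alignedPairs c c' l n, p.1 < n ∧ p.2 < n :=
    fun p hp => (mem_alignedPairs.1 hp).1
  have h1 := h (Finset.range n) ((alignedPairs c c' l n).image Prod.fst) (block S l)
    (Finset.image_subset_iff.2 fun p hp => Finset.mem_range.2 (hmem p hp).1)
    (by
      rwa [Finset.card_range, Finset.card_image_of_injOn (injOn_fst_alignedPairs hc hl)])
  have h2 := h (Finset.range n) ((alignedPairs c c' l n).image Prod.snd) (block T l)
    (Finset.image_subset_iff.2 fun p hp => Finset.mem_range.2 (hmem p hp).2)
    (by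
      rwa [Finset.card_range, Finset.card_image_of_injOn (injOn_snd_alignedPairs hc' hl)])
  rw [empEntropy_image _ _ _ (injOn_fst_alignedPairs hc hl), abs_le] at h1
  rw [empEntropy_image _ _ _ (injOn_snd_alignedPairs hc' hl), abs_le] at h2
  have h3 := empEntropy_le_add_log (alignedPairs c c' l n) (fun p => block S l p.1)
    (fun p => block T l p.2) R K hK hR (hST n)
  unfold blockEntropy
  linarith

end Alignment

section Digits

lemma cumLen_mono {α : Type*} (L : ℕ → List α) : Monotone (cumLen L) :=
  monotone_nat_of_le_succ fun _ => Nat.le_add_right _ _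

lemma concatSeq_eq_getD {α : Type*} (dflt : α) (L : ℕ → List α) {m k : ℕ} (h1 : cumLen L m ≤ k)
    (h2 : k < cumLen L (m + 1)) :
    concatSeq dflt L k = (L m).getD (k - cumLen L m) dflt := by
  classical
  have h : ∃ m, k < cumLen L (m + 1) := ⟨m, h2⟩
  have hfind : Nat.find h = m := by
    rw [Nat.find_eq_iff]
    refine ⟨h2, fun j hj => ?_⟩
    have := cumLen_mono L (show j + 1 ≤ m from hj)
    omega
  unfold concatSeq
  rw [dif_pos h]
  convert rfl using 3 <;> first | exact hfind.symm | (congr 1; exact hfind.symm)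

variable {b : ℕ} {hb : 0 < b}

/-- The `l` least significant base-`b` digits of `u`, most significant first. -/
def digitBlock (b : ℕ) (hb : 0 < b) (l u : ℕ) : Fin l → Fin b :=
  fun t => ⟨u / b ^ (l - 1 - t) % b, Nat.mod_lt _ hb⟩

lemma length_digitsFin (n : ℕ) : (digitsFin b hb n).length = (Nat.digits b n).length := by
  simp [digitsFin]

lemma digitsFin_getD (hb2 : 2 ≤ b) (n : ℕ) {t s : ℕ} (dflt : Fin b)
    (h : t + s + 1 = (Nat.digits b n).length) :
    (((digitsFin b hb n).getD t dflt : Fin b) : ℕ) = n / b ^ s % b := by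
  have ht : t < (digitsFin b hb n).length := by rw [length_digitsFin]; omega
  rw [List.getD_eq_getElem _ _ ht, ← Nat.getD_digits n s hb2,
    List.getD_eq_getElem _ _ (by omega)]
  have hs : (Nat.digits b n).length - 1 - t = s := by omega
  simp only [digitsFin, List.getElem_map, List.getElem_reverse, hs]
  exact Nat.mod_eq_of_lt (Nat.digits_lt_base (by omega) (List.getElem_mem _))

lemma block_concatSeq_digitsFin (hb2 : 2 ≤ b) (dflt : Fin b) (N : ℕ → ℕ) {l i k : ℕ}
    (h1 : cumLen (fun i => digitsFin b hb (N i)) k ≤ i)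
    (h2 : i + l ≤ cumLen (fun i => digitsFin b hb (N i)) (k + 1)) :
    block (concatSeq dflt (fun i => digitsFin b hb (N i))) l i =
      digitBlock b hb l
        (N k / b ^ (cumLen (fun i => digitsFin b hb (N i)) (k + 1) - (i + l))) := by
  have hcum : cumLen (fun i => digitsFin b hb (N i)) (k + 1) =
      cumLen (fun i => digitsFin b hb (N i)) k + (Nat.digits b (N k)).length := by
    rw [cumLen, length_digitsFin]
  funext t
  have ht := t.2
  apply Fin.ext
  rw [block, concatSeq_eq_getD dflt _ (m := k) (by omega) (by omega),
    digitsFin_getD (s := cumLen (fun i => digitsFin b hb (N i)) (k + 1) - (i + l) + (l - 1 - t))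
      hb2 _ _ (by omega), pow_add, ← Nat.div_div_eq_div_mul, digitBlock]

lemma digitBlock_mod (l u : ℕ) : digitBlock b hb l (u % b ^ l) = digitBlock b hb l u := by
  funext t
  have ht := t.2
  apply Fin.ext
  simp only [digitBlock]
  have hl : b ^ l = b ^ (l - 1 - t) * b ^ (t + 1 : ℕ) := by
    rw [← pow_add]; congr 1; omega
  rw [hl, Nat.mod_mul_right_div_self]
  exact Nat.mod_mod_of_dvd _ (dvd_pow_self b (Nat.succ_ne_zero _))

lemma mod_eq_of_digitBlock_eq {l u v : ℕ} (h : digitBlock b hb l u = digitBlock b hb l v) :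
    u % b ^ l = v % b ^ l := by
  have hdig : ∀ s < l, u / b ^ s % b = v / b ^ s % b := by
    intro s hs
    have h1 := congrArg Fin.val (congrFun h ⟨l - 1 - s, by omega⟩)
    simp only [digitBlock] at h1
    rwa [show l - 1 - (l - 1 - s) = s by omega] at h1
  clear h
  induction l with
  | zero => simp [Nat.mod_one]
  | succ l ih =>
    rw [Nat.mod_pow_succ, Nat.mod_pow_succ, ih fun s hs => hdig s (by omega),
      hdig l (Nat.lt_succ_self l)]

/-- If `d v` and `a u` differ by at most `C`, the last `l` digits of `u` determine those of `v`
up to `(2 C + 1) d` possibilities. -/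
lemma exists_digitBlock_relation (hb : 0 < b) (a d C : ℕ) (hd : 0 < d) (l : ℕ) :
    ∃ R : (Fin l → Fin b) → Finset (Fin l → Fin b), (∀ x, (R x).card ≤ (2 * C + 1) * d) ∧
      ∀ u v : ℕ, d * v ≤ a * u + C → a * u ≤ d * v + C →
        digitBlock b hb l v ∈ R (digitBlock b hb l u) := by
  refine ⟨fun x => (Finset.Icc (-(C : ℤ)) C ×ˢ Finset.range d).image fun p =>
    digitBlock b hb l ((((a * (Function.invFun (digitBlock b hb l) x : ℕ) + p.1 : ℤ) %
      (b ^ l : ℕ)).toNat + p.2 * b ^ l) / d), fun x => ?_, fun u v h1 h2 => ?_⟩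
  · refine Finset.card_image_le.trans (le_of_eq ?_)
    rw [Finset.card_product, Finset.card_range, Int.card_Icc]
    congr 1
    omega
  · have hu : Function.invFun (digitBlock b hb l) (digitBlock b hb l u) % b ^ l = u % b ^ l :=
      mod_eq_of_digitBlock_eq (Function.invFun_eq ⟨u, rfl⟩)
    set w := Function.invFun (digitBlock b hb l) (digitBlock b hb l u) with hw
    have hpos : 0 < b ^ l := pow_pos hb l
    have hv : v % b ^ l < b ^ l := Nat.mod_lt _ hpos
    refine Finset.mem_image.2 ⟨((d * v : ℤ) - a * u, d * (v % b ^ l) / b ^ l), ?_, ?_⟩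
    · rw [Finset.mem_product, Finset.mem_Icc, Finset.mem_range]
      zify at h1 h2
      refine ⟨⟨by dsimp only; linarith, by dsimp only; linarith⟩, ?_⟩
      rw [Nat.div_lt_iff_lt_mul hpos]
      exact Nat.mul_lt_mul_of_pos_left hv hd
    · have hmod : ((a * w + (d * v - a * u) : ℤ) % (b ^ l : ℕ)).toNat =
          d * (v % b ^ l) % b ^ l := by
        have hwu : (w : ℤ) ≡ u [ZMOD (b ^ l : ℕ)] := Int.natCast_modEq_iff.2 hu
        have h3 : (a * w + (d * v - a * u) : ℤ) ≡ a * u + (d * v - a * u) [ZMOD (b ^ l : ℕ)] :=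
          (hwu.mul_left _).add_right _
        rw [h3.eq, add_sub_cancel, Nat.mul_mod_mod]
        norm_cast
      dsimp only
      rw [hmod, mul_comm (d * (v % b ^ l) / b ^ l), Nat.mod_add_div,
        Nat.mul_div_cancel_left _ hd, digitBlock_mod]

lemma length_digits_le_add (hb2 : 2 ≤ b) {x y M : ℕ} (h : y + 1 ≤ M * (x + 1)) :
    (Nat.digits b y).length ≤ (Nat.digits b x).length + M := by
  rw [Nat.digits_length_le_iff (by omega)]
  have h1 : x < b ^ (Nat.digits b x).length := Nat.lt_base_pow_length_digits (by omega)
  have h2 : M < b ^ M := Nat.lt_pow_self (by omega)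
  calc y < M * (x + 1) := h
    _ ≤ b ^ M * b ^ (Nat.digits b x).length := Nat.mul_le_mul h2.le h1
    _ = b ^ ((Nat.digits b x).length + M) := by rw [← pow_add, add_comm]

lemma tendsto_length_digits (hb2 : 2 ≤ b) {N : ℕ → ℕ}
    (hN : Filter.Tendsto N Filter.atTop Filter.atTop) :
    Filter.Tendsto (fun k => (Nat.digits b (N k)).length) Filter.atTop Filter.atTop := by
  refine Filter.tendsto_atTop.2 fun M => ?_
  filter_upwards [hN.eventually_ge_atTop (b ^ M)] with k hk
  have h1 : N k < b ^ (Nat.digits b (N k)).length := Nat.lt_base_pow_length_digits (by omega)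
  exact (Nat.pow_lt_pow_iff_right (by omega)).1 (hk.trans_lt h1) |>.le

lemma mul_div_le_mul_div_add {a d C x y m : ℕ} (hm : 0 < m) (h : d * y ≤ a * x + C) :
    d * (y / m) ≤ a * (x / m) + (a + C) := by
  have h1 : m * (y / m) ≤ y := Nat.mul_div_le y m
  have h2 : x < m * (x / m + 1) := Nat.lt_mul_div_succ x hm
  have h3 : d * (m * (y / m)) ≤ d * y := Nat.mul_le_mul_left d h1
  have h4 : a * x ≤ a * (m * (x / m + 1)) := Nat.mul_le_mul_left a h2.le
  have h5 : C ≤ m * C := Nat.le_mul_of_pos_left C hm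
  refine Nat.le_of_mul_le_mul_left ?_ hm
  calc m * (d * (y / m)) = d * (m * (y / m)) := by ring
    _ ≤ a * (m * (x / m + 1)) + m * C := by omega
    _ = m * (a * (x / m) + (a + C)) := by ring

/-- Concatenating digit expansions of two sequences of naturals that are related by an affine
map up to a bounded error gives block entropies that differ by a constant. -/
lemma exists_eventually_blockEntropy_digits_le (hb2 : 2 ≤ b) (hb : 0 < b) (dflt : Fin b)
    {N Y : ℕ → ℕ}
    (hN : Filter.Tendsto N Filter.atTop Filter.atTop) {a d C : ℕ} (ha : 0 < a) (hd : 0 < d)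
    (h1 : ∀ k, d * Y k ≤ a * N k + C) (h2 : ∀ k, a * N k ≤ d * Y k + C) :
    ∃ c : ℝ, ∀ l, 0 < l → ∀ ε : ℝ, 0 < ε → ∀ᶠ n : ℕ in Filter.atTop,
      blockEntropy (concatSeq dflt (fun i => digitsFin b hb (Y i))) l n ≤
        blockEntropy (concatSeq dflt (fun i => digitsFin b hb (N i))) l n + c + ε := by
  have hsucc : ∀ M : ℕ → ℕ, ∀ k, cumLen (fun i => digitsFin b hb (M i)) (k + 1) =
      cumLen (fun i => digitsFin b hb (M i)) k + (Nat.digits b (M k)).length := fun M k => by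
    rw [cumLen, length_digitsFin]
  have hD : ∀ {a d C : ℕ} {M M' : ℕ → ℕ}, 0 < d → (∀ k, d * M' k ≤ a * M k + C) → ∀ k,
      (Nat.digits b (M' k)).length ≤ (Nat.digits b (M k)).length + (a + C + 1) := by
    intro a d C M M' hd h k
    refine length_digits_le_add hb2 ?_
    have h3 := h k
    have h4 : M' k ≤ d * M' k := Nat.le_mul_of_pos_left _ hd
    nlinarith [Nat.zero_le (C * M k), Nat.zero_le (M k)]
  refine ⟨Real.log ((2 * (a + d + C) + 1) * d : ℕ), fun l hl ε hε => ?_⟩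
  obtain ⟨R, hRcard, hR⟩ := exists_digitBlock_relation hb a d (a + d + C) hd l
  refine eventually_blockEntropy_le (c := cumLen fun i => digitsFin b hb (N i))
    (c' := cumLen fun i => digitsFin b hb (Y i)) (D := a + d + C + 1) rfl rfl
    (cumLen_mono _) (cumLen_mono _) (fun k => ?_) (fun k => ?_) ?_ hl R (by positivity) hRcard ?_ hε
  · have := hD ha h2 k
    rw [hsucc, hsucc]
    omega
  · have := hD hd h1 k
    rw [hsucc, hsucc]
    omega
  · simp only [hsucc, Nat.add_sub_cancel_left]
    exact tendsto_length_digits hb2 hN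
  · rintro n ⟨i, j⟩ hp
    obtain ⟨-, k, hk1, hk2, hk3, hk4, hk5⟩ := mem_alignedPairs.1 hp
    dsimp only at hk1 hk2 hk3 hk4 hk5 ⊢
    rw [block_concatSeq_digitsFin hb2 dflt N hk1 hk2, block_concatSeq_digitsFin hb2 dflt Y hk3 hk4]
    have hm : cumLen (fun i => digitsFin b hb (Y i)) (k + 1) - (j + l) =
        cumLen (fun i => digitsFin b hb (N i)) (k + 1) - (i + l) := by omega
    rw [hm]
    set m := cumLen (fun i => digitsFin b hb (N i)) (k + 1) - (i + l)
    have h3 := mul_div_le_mul_div_add (pow_pos hb m) (h1 k)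
    have h4 := mul_div_le_mul_div_add (pow_pos hb m) (h2 k)
    exact hR _ _ (by omega) (by omega)

end Digits

section Dimension

variable {f g : ℕ → ℝ} {B C : ℝ}

lemma liminf_le_liminf_add (hf : ∀ᶠ n in Filter.atTop, 0 ≤ f n)
    (hg : ∀ᶠ n in Filter.atTop, 0 ≤ g n) (hgB : ∀ᶠ n in Filter.atTop, g n ≤ B)
    (h : ∀ ε : ℝ, 0 < ε → ∀ᶠ n in Filter.atTop, f n ≤ g n + C + ε) :
    Filter.liminf f Filter.atTop ≤ Filter.liminf g Filter.atTop + C := by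
  refine le_of_forall_pos_le_add fun ε hε => ?_
  have hg1 : Filter.IsBoundedUnder (· ≥ ·) Filter.atTop g := ⟨0, Filter.eventually_map.2 hg⟩
  have hg2 : Filter.IsCoboundedUnder (· ≥ ·) Filter.atTop g :=
    Filter.IsBoundedUnder.isCoboundedUnder_ge ⟨B, Filter.eventually_map.2 hgB⟩
  have hgc : ∀ᶠ n in Filter.atTop, g n + (C + ε) ≤ B + (C + ε) :=
    hgB.mono fun n hn => by linarith
  rw [add_assoc, ← liminf_add_const Filter.atTop g (C + ε) hg2 hg1]
  exact Filter.liminf_le_liminf ((h ε hε).mono fun n hn => by linarith)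
    ⟨0, Filter.eventually_map.2 hf⟩
    (Filter.IsBoundedUnder.isCoboundedUnder_ge ⟨_, Filter.eventually_map.2 hgc⟩)

lemma limsup_le_limsup_add (hf : ∀ᶠ n in Filter.atTop, 0 ≤ f n)
    (hg : ∀ᶠ n in Filter.atTop, 0 ≤ g n) (hgB : ∀ᶠ n in Filter.atTop, g n ≤ B)
    (h : ∀ ε : ℝ, 0 < ε → ∀ᶠ n in Filter.atTop, f n ≤ g n + C + ε) :
    Filter.limsup f Filter.atTop ≤ Filter.limsup g Filter.atTop + C := by
  refine le_of_forall_pos_le_add fun ε hε => ?_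
  have hg1 : Filter.IsBoundedUnder (· ≤ ·) Filter.atTop g := ⟨B, Filter.eventually_map.2 hgB⟩
  have hg2 : Filter.IsCoboundedUnder (· ≤ ·) Filter.atTop g :=
    Filter.IsBoundedUnder.isCoboundedUnder_le ⟨0, Filter.eventually_map.2 hg⟩
  have hgc : ∀ᶠ n in Filter.atTop, g n + (C + ε) ≤ B + (C + ε) :=
    hgB.mono fun n hn => by linarith
  rw [add_assoc, ← limsup_add_const Filter.atTop g (C + ε) hg1 hg2]
  exact Filter.limsup_le_limsup ((h ε hε).mono fun n hn => by linarith)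
    (Filter.IsBoundedUnder.isCoboundedUnder_le ⟨0, Filter.eventually_map.2 hf⟩)
    ⟨_, Filter.eventually_map.2 hgc⟩

lemma iInf_succ_le_of_le_add_div {φ γ : ℕ → ℝ} (hγ : ∀ l, 0 < l → 0 ≤ γ l)
    (hφ : ∀ l, 0 < l → φ (l + l) ≤ φ l) (h : ∀ l, 0 < l → γ l ≤ φ l + C / l) :
    ⨅ l : ℕ, γ (l + 1) ≤ ⨅ l : ℕ, φ (l + 1) := by
  have hbdd : BddBelow (Set.range fun l : ℕ => γ (l + 1)) :=
    ⟨0, by rintro _ ⟨l, rfl⟩; exact hγ _ l.succ_pos⟩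
  refine le_ciInf fun l => ?_
  have hpow : ∀ k : ℕ, φ (2 ^ k * (l + 1)) ≤ φ (l + 1) := by
    intro k
    induction k with
    | zero => simp
    | succ k ih =>
      refine le_trans ?_ ih
      have h1 := hφ (2 ^ k * (l + 1)) (by positivity)
      rwa [← two_mul, ← mul_assoc, ← pow_succ'] at h1
  have hk : ∀ k : ℕ, ⨅ l : ℕ, γ (l + 1) ≤ φ (l + 1) + C / (2 ^ k * (l + 1) : ℕ) := by
    intro k
    have hpos : 0 < 2 ^ k * (l + 1) := by positivity
    have h1 := ciInf_le hbdd (2 ^ k * (l + 1) - 1)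
    rw [Nat.sub_add_cancel hpos] at h1
    linarith [h _ hpos, hpow k]
  have hlim : Filter.Tendsto (fun k : ℕ => φ (l + 1) + C / (2 ^ k * (l + 1) : ℕ))
      Filter.atTop (nhds (φ (l + 1) + 0)) := by
    refine Filter.Tendsto.const_add _ (Filter.Tendsto.const_div_atTop ?_ C)
    refine (tendsto_natCast_atTop_atTop (R := ℝ)).comp ?_
    exact (Filter.Tendsto.atTop_mul_const' (Nat.succ_pos l)
      (tendsto_pow_atTop_atTop_of_one_lt one_lt_two))
  rw [add_zero] at hlim
  exact ge_of_tendsto' hlim hk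

variable {α : Type*} [Fintype α] [DecidableEq α]

lemma eventually_slideH_bounds (S : ℕ → α) (l : ℕ) : ∀ᶠ n in Filter.atTop,
    0 ≤ slideH l (pre S n) ∧
      slideH l (pre S n) ≤ Fintype.card (Fin l → α) / (l * Real.log (Fintype.card α)) := by
  filter_upwards [Filter.eventually_ge_atTop l] with n hn
  have hlog : 0 ≤ l * Real.log (Fintype.card α) :=
    mul_nonneg (Nat.cast_nonneg l) (Real.log_natCast_nonneg _)
  rw [slideH_pre S (by omega)]
  exact ⟨div_nonneg (empEntropy_nonneg _ _) hlog,
    div_le_div_of_nonneg_right (empEntropy_le_card _ _) hlog⟩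

lemma eventually_slideH_add_self_le (hα : 1 < Fintype.card α) (S : ℕ → α) {l : ℕ} (hl : 0 < l)
    {ε : ℝ} (hε : 0 < ε) : ∀ᶠ n in Filter.atTop,
      slideH (l + l) (pre S n) ≤ slideH l (pre S n) + ε := by
  have hlog : 0 < Real.log (Fintype.card α) := Real.log_pos (by exact_mod_cast hα)
  have hl' : (0 : ℝ) < l := by exact_mod_cast hl
  have h1 := (Filter.tendsto_add_atTop_nat 1).eventually
    (eventually_blockEntropy_add_self_le S l
      (show 0 < ε / 3 * (2 * (l * Real.log (Fintype.card α))) by positivity))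
  filter_upwards [h1, eventually_abs_slideH_sub_blockRate_le S l hl hα (show 0 < ε / 3 by linarith),
    eventually_abs_slideH_sub_blockRate_le S (l + l) (by omega) hα (show 0 < ε / 3 by linarith)]
    with n h1 h2 h3
  have h4 : blockRate S (l + l) n ≤ blockRate S l n + ε / 3 := by
    unfold blockRate
    rw [div_le_iff₀ (by positivity)]
    refine h1.trans (le_of_eq ?_)
    push_cast
    field_simp
    ring
  rw [abs_le] at h2 h3
  linarith

/-- A bound on the growth of block entropies that is independent of the block length gives an
inequality between the finite-state dimensions. -/
lemma dimFS_le_and_DimFS_le (hα : 1 < Fintype.card α) {S T : ℕ → α} {c : ℝ}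
    (h : ∀ l, 0 < l → ∀ ε : ℝ, 0 < ε → ∀ᶠ n : ℕ in Filter.atTop,
      blockEntropy T l n ≤ blockEntropy S l n + c + ε) :
    dimFS T ≤ dimFS S ∧ DimFS T ≤ DimFS S := by
  have hlog : 0 < Real.log (Fintype.card α) := Real.log_pos (by exact_mod_cast hα)
  have hTS : ∀ l, 0 < l → ∀ ε : ℝ, 0 < ε → ∀ᶠ n in Filter.atTop,
      slideH l (pre T n) ≤ slideH l (pre S n) + c / Real.log (Fintype.card α) / l + ε := by
    intro l hl ε hε
    have hl' : (0 : ℝ) < l := by exact_mod_cast hl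
    have h1 := (Filter.tendsto_add_atTop_nat 1).eventually
      (h l hl (ε / 3 * (l * Real.log (Fintype.card α))) (by positivity))
    filter_upwards [h1,
      eventually_abs_slideH_sub_blockRate_le S l hl hα (show 0 < ε / 3 by linarith),
      eventually_abs_slideH_sub_blockRate_le T l hl hα (show 0 < ε / 3 by linarith)]
      with n h1 h2 h3
    have h4 : blockRate T l n ≤ blockRate S l n + c / Real.log (Fintype.card α) / l + ε / 3 := by
      unfold blockRate
      rw [div_le_iff₀ (by positivity)]
      refine h1.trans (le_of_eq ?_)
      field_simp
    rw [abs_le] at h2 h3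
    linarith
  have h0 : ∀ (U : ℕ → α) l, ∀ᶠ n in Filter.atTop, 0 ≤ slideH l (pre U n) := fun U l =>
    (eventually_slideH_bounds U l).mono fun n hn => hn.1
  have hB : ∀ (U : ℕ → α) l, ∀ᶠ n in Filter.atTop, slideH l (pre U n) ≤
      Fintype.card (Fin l → α) / (l * Real.log (Fintype.card α)) := fun U l =>
    (eventually_slideH_bounds U l).mono fun n hn => hn.2
  have hdbl : ∀ l, 0 < l → ∀ ε : ℝ, 0 < ε → ∀ᶠ n in Filter.atTop,
      slideH (l + l) (pre S n) ≤ slideH l (pre S n) + 0 + ε := fun l hl ε hε => by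
    simpa using eventually_slideH_add_self_le hα S hl hε
  have hliminf0 : ∀ (U : ℕ → α) l,
      0 ≤ Filter.liminf (fun n => slideH l (pre U n)) Filter.atTop := fun U l =>
    Filter.le_liminf_of_le
      (Filter.IsBoundedUnder.isCoboundedUnder_ge ⟨_, Filter.eventually_map.2 (hB U l)⟩) (h0 U l)
  constructor
  · refine iInf_succ_le_of_le_add_div (C := c / Real.log (Fintype.card α))
      (γ := fun l => Filter.liminf (fun n => slideH l (pre T n)) Filter.atTop)
      (φ := fun l => Filter.liminf (fun n => slideH l (pre S n)) Filter.atTop)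
      (fun l _ => hliminf0 T l) (fun l hl => ?_) (fun l hl => ?_)
    · simpa using liminf_le_liminf_add (h0 S _) (h0 S l) (hB S l) (hdbl l hl)
    · exact liminf_le_liminf_add (h0 T l) (h0 S l) (hB S l) (hTS l hl)
  · refine iInf_succ_le_of_le_add_div (C := c / Real.log (Fintype.card α))
      (γ := fun l => Filter.limsup (fun n => slideH l (pre T n)) Filter.atTop)
      (φ := fun l => Filter.limsup (fun n => slideH l (pre S n)) Filter.atTop)
      (fun l _ => (hliminf0 T l).trans (Filter.liminf_le_limsup
        ⟨_, Filter.eventually_map.2 (hB T l)⟩ ⟨_, Filter.eventually_map.2 (h0 T l)⟩))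
      (fun l hl => ?_) (fun l hl => ?_)
    · simpa using limsup_le_limsup_add (h0 S _) (h0 S l) (hB S l) (hdbl l hl)
    · exact limsup_le_limsup_add (h0 T l) (h0 S l) (hB S l) (hTS l hl)

end Dimension

lemma pos_of_infinite_of_nonneg {q r : ℚ} (hq : q ≠ 0) {A : Set ℕ} (hA : A.Infinite)
    (hpos : ∀ n ∈ A, 0 ≤ (q : ℝ) * n + (r : ℝ)) : 0 < q := by
  by_contra hneg
  have hq' : (q : ℝ) < 0 := by exact_mod_cast lt_of_le_of_ne (not_lt.1 hneg) hq
  obtain ⟨m, hm⟩ := exists_nat_gt ((r : ℝ) / -q)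
  obtain ⟨n, hn, hmn⟩ := hA.exists_gt m
  have h1 := hpos n hn
  rw [div_lt_iff₀ (by linarith)] at hm
  have h2 : (m : ℝ) < n := by exact_mod_cast hmn
  nlinarith

/-- Let `p(x) = qx + r` with `q, r ∈ ℚ`, `q ≠ 0`. For every base
`b ≥ 2` and every infinite `A ⊆ ℕ` with `p(n) ≥ 0` for all `n ∈ A`,
`dim_FS(CE_b(A)) = dim_FS(CE_b(p(A)))` and `Dim_FS(CE_b(A)) = Dim_FS(CE_b(p(A)))`,
where `CE_b(p(A))` concatenates the base-`b` expansions of `⌊p(n)⌋` for `n ∈ A` in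
increasing order of `n`. -/
theorem stmt9 (q r : ℚ) (hq : q ≠ 0) (b : ℕ) (hb : 2 ≤ b)
    (A : Set ℕ) (hA : A.Infinite)
    (hpos : ∀ n ∈ A, 0 ≤ (q : ℝ) * n + (r : ℝ)) :
    dimFS (CEseq b (by omega) A) =
      dimFS (CEseqF b (by omega) A (fun n => (q : ℝ) * n + (r : ℝ))) ∧
    DimFS (CEseq b (by omega) A) =
      DimFS (CEseqF b (by omega) A (fun n => (q : ℝ) * n + (r : ℝ))) := by
  have hq0 := pos_of_infinite_of_nonneg hq hA hpos
  set N : ℕ → ℕ := Nat.nth (· ∈ A) with hN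
  set Y : ℕ → ℕ := fun k => ⌊(q : ℝ) * N k + (r : ℝ)⌋₊ with hY
  have hNmono : StrictMono N := Nat.nth_strictMono hA
  have hNtop : Filter.Tendsto N Filter.atTop Filter.atTop := hNmono.tendsto_atTop
  have hnum : (q.num.toNat : ℤ) = q.num := Int.toNat_of_nonneg (Rat.num_pos.2 hq0).le
  have ha : 0 < q.num.toNat := by have := Rat.num_pos.2 hq0; omega
  have hd : 0 < q.den := q.den_pos
  have hd' : (0 : ℝ) < q.den := by exact_mod_cast hd
  have hqd : (q.num.toNat : ℝ) = q.den * q := by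
    have h1 : (q.num.toNat : ℝ) = (q.num : ℝ) := by exact_mod_cast congrArg (Int.cast (R := ℝ)) hnum
    rw [h1]
    exact_mod_cast (Rat.den_mul_eq_num q).symm
  obtain ⟨C, hC⟩ := exists_nat_ge ((q.den : ℝ) * (|(r : ℝ)| + 1))
  have hrl := mul_le_mul_of_nonneg_left (neg_abs_le (r : ℝ)) hd'.le
  have hru := mul_le_mul_of_nonneg_left (le_abs_self (r : ℝ)) hd'.le
  have h1 : ∀ k, q.den * Y k ≤ q.num.toNat * N k + C := by
    intro k
    have hfl := mul_le_mul_of_nonneg_left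
      (Nat.floor_le (hpos (N k) (Nat.nth_mem_of_infinite hA k))) hd'.le
    have : (q.den : ℝ) * Y k ≤ q.num.toNat * N k + C := by
      rw [hqd]
      linarith
    exact_mod_cast this
  have h2 : ∀ k, q.num.toNat * N k ≤ q.den * Y k + C := by
    intro k
    have hfl := mul_le_mul_of_nonneg_left
      (Nat.lt_floor_add_one ((q : ℝ) * N k + (r : ℝ))).le hd'.le
    have : (q.num.toNat : ℝ) * N k ≤ q.den * Y k + C := by
      rw [hqd]
      linarith
    exact_mod_cast this
  have hYtop : Filter.Tendsto Y Filter.atTop Filter.atTop := by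
    refine Filter.tendsto_atTop.2 fun M => ?_
    filter_upwards [hNtop.eventually_ge_atTop (q.den * M + C)] with k hk
    have h3 : q.den * M ≤ q.den * Y k := by
      have := Nat.le_mul_of_pos_left (N k) ha
      have := h2 k
      omega
    exact Nat.le_of_mul_le_mul_left h3 hd
  have hcard : 1 < Fintype.card (Fin b) := by rw [Fintype.card_fin]; omega
  have hb0 : 0 < b := by omega
  obtain ⟨c, hc⟩ := exists_eventually_blockEntropy_digits_le hb hb0 ⟨0, hb0⟩ hNtop ha hd h1 h2
  obtain ⟨c', hc'⟩ := exists_eventually_blockEntropy_digits_le hb hb0 ⟨0, hb0⟩ hYtop hd ha h2 h1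
  have hle := dimFS_le_and_DimFS_le hcard hc
  have hge := dimFS_le_and_DimFS_le hcard hc'
  exact ⟨le_antisymm hge.1 hle.1, le_antisymm hge.2 hle.2⟩
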